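/- Let X be a compact ultrametric space and p ∈ [1,∞). Let B₀ denote the collection of all subsets B of X that are closed balls, satisfy B ⊊ X, and admit a parent, i.e. a smallest (for inclusion) closed ball B* of X strictly containing B. Then B₀ is countable, and for all Borel probability measures μ, ν on X one has W_p(μ,ν)^p = (1/2)·Σ_{B ∈ B₀} ((diam B*)^p − (diam B)^p)·|μ(B) − ν(B)|, where the sum (which converges unconditionally) runs over all B ∈ B₀, B* denoting the parent of B. -/

import Mathlib

open MeasureTheory
open scoped ENNReal NNReal

/-- A coupling of `μ` and `ν`. -/
def IsCoupling {X : Type*} [MeasurableSpace X] (π : Measure (X × X)) (μ ν : Measure X) : Prop :=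
  IsProbabilityMeasure π ∧ π.map Prod.fst = μ ∧ π.map Prod.snd = ν

/-- The `L^p` Wasserstein distance between two (probability) measures. -/
noncomputable def Wp {X : Type*} [MetricSpace X] [MeasurableSpace X] (p : ℝ)
    (μ ν : Measure X) : ℝ :=
  sInf {c : ℝ | ∃ π : Measure (X × X), IsCoupling π μ ν ∧
      c = ∫ ab, dist ab.1 ab.2 ^ p ∂π} ^ (1 / p)

/-- `B` is a (nonempty) closed ball of `X`. -/
def IsCBall {X : Type*} [MetricSpace X] (B : Set X) : Prop :=
  ∃ (x : X) (r : ℝ), 0 ≤ r ∧ B = Metric.closedBall x r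

/-- The family of closed balls that are proper subsets of `X` and admit a parent, i.e. a
smallest closed ball strictly containing them. -/
def BallsWithParent (X : Type*) [MetricSpace X] : Set (Set X) :=
  {B | IsCBall B ∧ B ≠ Set.univ ∧ ∃ B', IsLeast {C | IsCBall C ∧ B ⊂ C} B'}

section Ultrametric

variable {X : Type*} [MetricSpace X]

lemma IsCBall.isClosed {B : Set X} (hB : IsCBall B) : IsClosed B := by
  obtain ⟨x, r, -, rfl⟩ := hB
  exact Metric.isClosed_closedBall

variable [IsUltrametricDist X]

lemma IsCBall.exists_eq_closedBall {B : Set X} (hB : IsCBall B) {a : X} (ha : a ∈ B) :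
    ∃ r, 0 ≤ r ∧ B = Metric.closedBall a r := by
  obtain ⟨x, r, hr, rfl⟩ := hB
  exact ⟨r, hr, IsUltrametricDist.closedBall_eq_of_mem ha⟩

lemma IsUltrametricDist.diam_closedBall_le (a : X) {r : ℝ} (hr : 0 ≤ r) :
    Metric.diam (Metric.closedBall a r) ≤ r := by
  refine Metric.diam_le_of_forall_dist_le hr fun x hx y hy => ?_
  refine (IsUltrametricDist.dist_triangle_max x a y).trans (max_le hx ?_)
  rw [dist_comm]
  exact hy

/-- Two intersecting balls are nested. -/
lemma IsCBall.ssubset_of_not_subset {B : Set X} (hB : IsCBall B) {a : X} (ha : a ∈ B) {r : ℝ}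
    (h : ¬ Metric.closedBall a r ⊆ B) : B ⊂ Metric.closedBall a r := by
  obtain ⟨s, -, rfl⟩ := hB.exists_eq_closedBall ha
  refine ⟨Metric.closedBall_subset_closedBall ?_, h⟩
  by_contra! hlt
  exact h (Metric.closedBall_subset_closedBall hlt.le)

lemma closedBall_subset_of_lt_diam_parent [CompactSpace X] {B C : Set X} (hB : IsCBall B)
    (hC : IsLeast {C | IsCBall C ∧ B ⊂ C} C) {a : X} (ha : a ∈ B) {r : ℝ} (hr : 0 ≤ r)
    (h : r < Metric.diam C) : Metric.closedBall a r ⊆ B := by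
  by_contra hsub
  have hCsub : C ⊆ Metric.closedBall a r :=
    hC.2 ⟨⟨a, r, hr, rfl⟩, hB.ssubset_of_not_subset ha hsub⟩
  have := Metric.diam_mono hCsub Metric.isBounded_closedBall
  linarith [IsUltrametricDist.diam_closedBall_le a hr]

lemma eq_closedBall_of_diam_le_of_lt [CompactSpace X] {B C : Set X} (hB : IsCBall B)
    (hC : IsLeast {C | IsCBall C ∧ B ⊂ C} C) {a : X} (ha : a ∈ B) {r : ℝ}
    (h₁ : Metric.diam B ≤ r) (h₂ : r < Metric.diam C) : B = Metric.closedBall a r := by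
  refine Set.Subset.antisymm (fun x hx => ?_)
    (closedBall_subset_of_lt_diam_parent hB hC ha (Metric.diam_nonneg.trans h₁) h₂)
  exact (Metric.dist_le_diam_of_mem (Metric.isBounded_of_compactSpace) hx ha).trans h₁

lemma diam_parent_le_dist {B C : Set X} (hB : IsCBall B)
    (hC : IsLeast {C | IsCBall C ∧ B ⊂ C} C) {a b : X} (ha : a ∈ B) (hb : b ∉ B) :
    Metric.diam C ≤ dist a b := by
  have hCsub : C ⊆ Metric.closedBall a (dist a b) := by
    refine hC.2 ⟨⟨a, _, dist_nonneg, rfl⟩, hB.ssubset_of_not_subset ha fun h => hb (h ?_)⟩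
    rw [Metric.mem_closedBall, dist_comm]
  exact (Metric.diam_mono hCsub Metric.isBounded_closedBall).trans
    (IsUltrametricDist.diam_closedBall_le a dist_nonneg)

omit [IsUltrametricDist X] in
lemma diam_parent_pos [CompactSpace X] {B C : Set X} (hB : IsCBall B)
    (hC : IsLeast {C | IsCBall C ∧ B ⊂ C} C) : 0 < Metric.diam C := by
  obtain ⟨x, r, hr, rfl⟩ := hB
  obtain ⟨y, hyC, hyB⟩ := Set.exists_of_ssubset hC.1.2
  have hx : x ∈ Metric.closedBall x r := Metric.mem_closedBall_self hr
  have hxy : y ≠ x := fun h => hyB (h ▸ hx)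
  exact (dist_pos.2 hxy).trans_le
    (Metric.dist_le_diam_of_mem Metric.isBounded_of_compactSpace hyC (hC.1.2.1 hx))

/-- A proper closed ball of positive radius has a parent, of diameter larger than that radius. -/
lemma exists_parent_closedBall [CompactSpace X] {a b : X} {r : ℝ} (hr : 0 < r)
    (hab : r < dist a b) :
    ∃ C, IsLeast {C | IsCBall C ∧ Metric.closedBall a r ⊂ C} C ∧ r < Metric.diam C := by
  have hb : b ∈ (Metric.closedBall a r)ᶜ := by
    simpa [dist_comm] using hab
  have hK : IsCompact (Metric.closedBall a r)ᶜ :=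
    (IsUltrametricDist.isOpen_closedBall a hr.ne').isClosed_compl.isCompact
  obtain ⟨y, hy, hmin⟩ := hK.exists_isMinOn ⟨b, hb⟩
    (f := fun y => dist y a) (by fun_prop)
  have hry : r < dist y a := by simpa using hy
  have hmem : y ∈ Metric.closedBall a (dist y a) := Metric.mem_closedBall.2 le_rfl
  refine ⟨Metric.closedBall a (dist y a), ⟨⟨⟨a, _, dist_nonneg, rfl⟩,
    Metric.closedBall_subset_closedBall hry.le, fun h => hy (h hmem)⟩, ?_⟩, ?_⟩
  · rintro C ⟨hC, hsub⟩
    obtain ⟨s, hs, rfl⟩ := hC.exists_eq_closedBall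
      (hsub.1 (Metric.mem_closedBall_self hr.le))
    obtain ⟨z, hz, hz'⟩ := Set.exists_of_ssubset hsub
    exact Metric.closedBall_subset_closedBall ((isMinOn_iff.1 hmin z hz').trans hz)
  · exact hry.trans_le (Metric.dist_le_diam_of_mem Metric.isBounded_closedBall hmem
      (Metric.mem_closedBall_self dist_nonneg))

lemma finite_ballsWithParent_lt_diam [CompactSpace X] {ε : ℝ} (hε : 0 < ε) :
    {B : Set X | IsCBall B ∧
      ∃ C, IsLeast {C | IsCBall C ∧ B ⊂ C} C ∧ ε < Metric.diam C}.Finite := by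
  obtain ⟨t, -, ht, hcov⟩ := finite_cover_balls_of_compact (isCompact_univ (X := X)) hε
  refine (ht.powerset.image fun s => ⋃ x ∈ s, Metric.closedBall x ε).subset ?_
  rintro B ⟨hB, C, hC, hεC⟩
  refine ⟨t ∩ B, Set.inter_subset_left, Set.Subset.antisymm ?_ fun y hy => ?_⟩
  · exact Set.iUnion₂_subset fun x hx =>
      closedBall_subset_of_lt_diam_parent hB hC hx.2 hε.le hεC
  · obtain ⟨x, hx, hyx⟩ := Set.mem_iUnion₂.1 (hcov (Set.mem_univ y))
    have hyx' : y ∈ Metric.closedBall x ε := Metric.ball_subset_closedBall hyx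
    refine Set.mem_iUnion₂.2 ⟨x, ⟨hx, ?_⟩, hyx'⟩
    exact closedBall_subset_of_lt_diam_parent hB hC hy hε.le hεC
      (Metric.mem_closedBall_comm.1 hyx')

lemma countable_ballsWithParent [CompactSpace X] : (BallsWithParent X).Countable := by
  refine (Set.countable_iUnion fun n : ℕ =>
    (finite_ballsWithParent_lt_diam (X := X) (ε := 1 / ((n : ℝ) + 1))
      (by positivity)).countable).mono ?_
  rintro B ⟨hB, -, C, hC⟩
  obtain ⟨n, hn⟩ := exists_nat_one_div_lt (diam_parent_pos hB hC)
  exact Set.mem_iUnion.2 ⟨n, hB, C, hC, hn⟩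

/-- Distinct balls containing a common point give disjoint intervals of diameters. -/
lemma tsum_diam_rpow_sub_eq_volume [CompactSpace X] {p : ℝ} (hp : 0 < p) {par : Set X → Set X}
    (hpar : ∀ B ∈ BallsWithParent X, IsLeast {C | IsCBall C ∧ B ⊂ C} (par B)) (a : X)
    {S : Set (Set X)} (hS : ∀ B ∈ S, a ∈ B) :
    ∑' B : BallsWithParent X, S.indicator (fun B =>
        ENNReal.ofReal (Metric.diam (par B) ^ p - Metric.diam B ^ p)) (B : Set X) =
      volume {t : ℝ | ∃ B ∈ BallsWithParent X, B ∈ S ∧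
        Metric.diam B ^ p ≤ t ∧ t < Metric.diam (par B) ^ p} := by
  classical
  have : Countable (BallsWithParent X) := countable_ballsWithParent.to_subtype
  let J : BallsWithParent X → Set ℝ := fun B =>
    if (B : Set X) ∈ S then Set.Ico (Metric.diam (B : Set X) ^ p) (Metric.diam (par B) ^ p) else ∅
  have hJ : {t : ℝ | ∃ B ∈ BallsWithParent X, B ∈ S ∧
        Metric.diam B ^ p ≤ t ∧ t < Metric.diam (par B) ^ p} = ⋃ B, J B := by
    ext t
    simp only [Set.mem_ofPred_eq, Set.mem_iUnion, J]
    constructor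
    · rintro ⟨B, hB, hBS, h⟩
      exact ⟨⟨B, hB⟩, by simpa [hBS] using h⟩
    · rintro ⟨B, hB⟩
      split_ifs at hB with h
      · exact ⟨B, B.2, h, hB⟩
      · exact hB.elim
  rw [hJ, measure_iUnion]
  · refine tsum_congr fun B => ?_
    by_cases h : (B : Set X) ∈ S <;> simp [J, h]
  · intro B B' hne
    refine Set.disjoint_left.2 fun t ht ht' => hne (Subtype.ext ?_)
    simp only [J] at ht ht'
    split_ifs at ht ht' with h h'
    · have ht0 : 0 ≤ t := le_trans (by positivity) ht.1
      have key : ∀ D : BallsWithParent X, (D : Set X) ∈ S → Metric.diam (D : Set X) ^ p ≤ t →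
          t < Metric.diam (par D) ^ p → (D : Set X) = Metric.closedBall a (t ^ p⁻¹) :=
        fun D hD h₁ h₂ => eq_closedBall_of_diam_le_of_lt D.2.1 (hpar D D.2) (hS D hD)
          ((Real.le_rpow_inv_iff_of_pos Metric.diam_nonneg ht0 hp).2 h₁)
          ((Real.rpow_inv_lt_iff_of_pos ht0 Metric.diam_nonneg hp).2 h₂)
      rw [key B h ht.1 ht.2, key B' h' ht'.1 ht'.2]
    all_goals simp_all
  · intro B
    simp only [J]
    split_ifs
    · exact measurableSet_Ico
    · exact MeasurableSet.empty

lemma tsum_diam_rpow_sub_separating [CompactSpace X] {p : ℝ} (hp : 0 < p) {par : Set X → Set X}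
    (hpar : ∀ B ∈ BallsWithParent X, IsLeast {C | IsCBall C ∧ B ⊂ C} (par B)) (a b : X) :
    ∑' B : BallsWithParent X, {B : Set X | a ∈ B ∧ b ∉ B}.indicator (fun B =>
        ENNReal.ofReal (Metric.diam (par B) ^ p - Metric.diam B ^ p)) (B : Set X) =
      ENNReal.ofReal (dist a b ^ p) := by
  rw [tsum_diam_rpow_sub_eq_volume hp hpar a fun B hB => hB.1]
  refine le_antisymm ?_ ?_
  · calc _ ≤ volume (Set.Ico 0 (dist a b ^ p)) := by
          refine measure_mono ?_
          rintro t ⟨B, hB, ⟨ha, hb⟩, h₁, h₂⟩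
          refine ⟨le_trans (by positivity) h₁, h₂.trans_le ?_⟩
          exact Real.rpow_le_rpow Metric.diam_nonneg
            (diam_parent_le_dist hB.1 (hpar B hB) ha hb) hp.le
      _ = _ := by simp
  · calc _ = volume (Set.Ioo 0 (dist a b ^ p)) := by simp
      _ ≤ _ := by
          refine measure_mono ?_
          rintro t ⟨ht₀, ht⟩
          have hr : 0 < t ^ p⁻¹ := by positivity
          have hrd : t ^ p⁻¹ < dist a b :=
            (Real.rpow_inv_lt_iff_of_pos ht₀.le dist_nonneg hp).2 ht
          obtain ⟨C, hC, hrC⟩ := exists_parent_closedBall hr hrd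
          have hb : b ∉ Metric.closedBall a (t ^ p⁻¹) := by
            simpa [dist_comm] using hrd
          have hB : Metric.closedBall a (t ^ p⁻¹) ∈ BallsWithParent X :=
            ⟨⟨a, _, hr.le, rfl⟩, fun h => hb (h ▸ Set.mem_univ b), C, hC⟩
          refine ⟨_, hB, ⟨Metric.mem_closedBall_self hr.le, hb⟩, ?_, ?_⟩
          · exact (Real.le_rpow_inv_iff_of_pos Metric.diam_nonneg ht₀.le hp).1
              (IsUltrametricDist.diam_closedBall_le a hr.le)
          · rw [(hpar _ hB).unique hC]
            exact (Real.rpow_inv_lt_iff_of_pos ht₀.le Metric.diam_nonneg hp).1 hrC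

lemma tsum_diam_rpow_sub_small_le [CompactSpace X] {p : ℝ} (hp : 0 < p) {par : Set X → Set X}
    (hpar : ∀ B ∈ BallsWithParent X, IsLeast {C | IsCBall C ∧ B ⊂ C} (par B)) (a : X) (ε : ℝ) :
    ∑' B : BallsWithParent X, {B : Set X | a ∈ B ∧ Metric.diam (par B) ≤ ε}.indicator (fun B =>
        ENNReal.ofReal (Metric.diam (par B) ^ p - Metric.diam B ^ p)) (B : Set X) ≤
      ENNReal.ofReal (ε ^ p) := by
  rw [tsum_diam_rpow_sub_eq_volume hp hpar a fun B hB => hB.1]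
  calc _ ≤ volume (Set.Ico 0 (ε ^ p)) := by
        refine measure_mono ?_
        rintro t ⟨B, hB, ⟨-, hle⟩, h₁, h₂⟩
        exact ⟨le_trans (by positivity) h₁,
          h₂.trans_le (Real.rpow_le_rpow Metric.diam_nonneg hle hp.le)⟩
    _ = _ := by simp

end Ultrametric

section Laminar

variable {X : Type*} [MeasurableSpace X]

lemma exists_measure_prod_of_univ_eq (μ ν : Measure X) [IsFiniteMeasure μ] [IsFiniteMeasure ν]
    (h : μ Set.univ = ν Set.univ) :
    ∃ π : Measure (X × X), π.map Prod.fst = μ ∧ π.map Prod.snd = ν := by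
  by_cases h0 : μ = 0
  · subst h0
    have hν : ν = 0 := by
      rw [← Measure.measure_univ_eq_zero, ← h]
      simp
    exact ⟨0, by simp, by simp [hν]⟩
  · have hμ : μ Set.univ ≠ 0 := by simpa using h0
    refine ⟨(μ Set.univ)⁻¹ • μ.prod ν, ?_, ?_⟩
    · rw [Measure.map_smul, Measure.map_fst_prod, ← h, smul_smul,
        ENNReal.inv_mul_cancel hμ (measure_ne_top _ _), one_smul]
    · rw [Measure.map_smul, Measure.map_snd_prod, smul_smul,
        ENNReal.inv_mul_cancel hμ (measure_ne_top _ _), one_smul]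

/-- If `ν B` is at least `μ B`, then the part of `μ` in `B` can be transported inside `B`. -/
lemma exists_measure_prod_restrict {μ ν : Measure X} [IsFiniteMeasure μ] [IsFiniteMeasure ν]
    {B : Set X} (hB : MeasurableSet B) (h : μ B ≤ ν B) :
    ∃ (ρ : Measure (X × X)) (ν' : Measure X), ρ.map Prod.fst = μ.restrict B ∧
      ρ.map Prod.snd + ν' = ν ∧ ρ (B ×ˢ B)ᶜ = 0 := by
  obtain ⟨t, ht⟩ : ∃ t, μ B / ν B + t = 1 := by
    refine exists_add_of_le (ENNReal.div_le_of_le_mul (by simpa using h)) |>.imp fun _ h => h.symm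
  refine ⟨(ν B)⁻¹ • (μ.restrict B).prod (ν.restrict B),
    t • ν.restrict B + ν.restrict Bᶜ, ?_, ?_, ?_⟩
  · rw [Measure.map_smul, Measure.map_fst_prod, Measure.restrict_apply_univ, smul_smul]
    by_cases h0 : ν B = 0
    · have : μ.restrict B = 0 := Measure.restrict_eq_zero.2 (le_antisymm (h0 ▸ h) bot_le)
      simp [this]
    · rw [ENNReal.inv_mul_cancel h0 (measure_ne_top _ _), one_smul]
  · rw [Measure.map_smul, Measure.map_snd_prod, Measure.restrict_apply_univ, smul_smul,
      ← add_assoc, ← add_smul, mul_comm, ← div_eq_mul_inv, ht, one_smul,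
      Measure.restrict_add_restrict_compl hB]
  · rw [Measure.smul_apply, Measure.prod_restrict,
      Measure.restrict_apply (hB.prod hB).compl]
    simp

/-- For a finite laminar family of sets, mass can be transported so that each set of the family
is crossed in at most one direction. -/
lemma exists_laminar_measure_prod (F : Finset (Set X)) (hF : ∀ B ∈ F, MeasurableSet B)
    (hlam : ∀ B ∈ F, ∀ C ∈ F, B ⊆ C ∨ C ⊆ B ∨ Disjoint B C)
    (μ ν : Measure X) [IsFiniteMeasure μ] [IsFiniteMeasure ν] (h : μ Set.univ = ν Set.univ) :
    ∃ π : Measure (X × X), π.map Prod.fst = μ ∧ π.map Prod.snd = ν ∧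
      ∀ B ∈ F, π (B ×ˢ Bᶜ) = 0 ∨ π (Bᶜ ×ˢ B) = 0 := by
  classical
  induction F using Finset.strongInduction generalizing μ ν with
  | H F ih =>
  obtain rfl | hne := F.eq_empty_or_nonempty
  · obtain ⟨π, h₁, h₂⟩ := exists_measure_prod_of_univ_eq μ ν h
    exact ⟨π, h₁, h₂, by simp⟩
  obtain ⟨B, hBF, hBmin⟩ := F.exists_minimal hne
  have hB := hF B hBF
  wlog hle : μ B ≤ ν B generalizing μ ν
  · obtain ⟨π, h₁, h₂, h₃⟩ := this ν μ h.symm (le_of_not_ge hle)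
    refine ⟨π.map Prod.swap, ?_, ?_, fun C hC => ?_⟩
    · rw [Measure.map_map measurable_fst measurable_swap]
      exact h₂
    · rw [Measure.map_map measurable_snd measurable_swap]
      exact h₁
    · have hC' := hF C hC
      rw [Measure.map_apply measurable_swap (hC'.prod hC'.compl),
        Measure.map_apply measurable_swap (hC'.compl.prod hC'),
        Set.preimage_swap_prod, Set.preimage_swap_prod]
      exact (h₃ C hC).symm
  obtain ⟨ρ, ν', h₁, h₂, h₃⟩ := exists_measure_prod_restrict hB hle
  have hν' : IsFiniteMeasure ν' := by
    refine isFiniteMeasure_of_le ν ?_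
    rw [← h₂]
    exact Measure.le_add_left le_rfl
  have hmass : μ.restrict Bᶜ Set.univ = ν' Set.univ := by
    have e₁ : ρ.map Prod.snd Set.univ = μ B := by
      rw [Measure.map_apply measurable_snd MeasurableSet.univ, Set.preimage_univ,
        ← Set.preimage_univ (f := Prod.fst), ← Measure.map_apply measurable_fst MeasurableSet.univ,
        h₁, Measure.restrict_apply_univ]
    have e₂ : μ B + μ Bᶜ = μ B + ν' Set.univ := by
      rw [measure_add_measure_compl hB, h, ← e₁, ← Measure.add_apply, h₂]
    rw [Measure.restrict_apply_univ]
    exact (ENNReal.add_right_inj (measure_ne_top _ _)).1 e₂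
  obtain ⟨π, g₁, g₂, g₃⟩ := ih (F.erase B) (Finset.erase_ssubset hBF)
    (fun C hC => hF C (Finset.mem_of_mem_erase hC))
    (fun C hC D hD => hlam C (Finset.mem_of_mem_erase hC) D (Finset.mem_of_mem_erase hD))
    (μ.restrict Bᶜ) ν' hmass
  refine ⟨ρ + π, ?_, ?_, fun C hC => ?_⟩
  · rw [Measure.map_add _ _ measurable_fst, h₁, g₁, Measure.restrict_add_restrict_compl hB]
  · rw [Measure.map_add _ _ measurable_snd, g₂, h₂]
  have hρ : ∀ S : Set (X × X), Disjoint S (B ×ˢ B) → ρ S = 0 := fun S hS =>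
    measure_mono_null hS.subset_compl_right h₃
  by_cases hCB : C = B
  · subst hCB
    left
    rw [Measure.add_apply, hρ _ (Set.disjoint_left.2 fun x hx hx' => hx.2 hx'.2), zero_add]
    refine measure_mono_null (t := Prod.fst ⁻¹' C) (fun x hx => hx.1) ?_
    rw [← Measure.map_apply measurable_fst hB, g₁, Measure.restrict_apply hB]
    simp
  · have hsep : B ⊆ C ∨ Disjoint B C := by
      rcases hlam B hBF C hC with h | h | h
      · exact Or.inl h
      · exact Or.inl (hBmin hC h)
      · exact Or.inr h
    have d₁ : Disjoint (C ×ˢ Cᶜ) (B ×ˢ B) := by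
      refine Set.disjoint_left.2 fun x hx hx' => ?_
      rcases hsep with h | h
      · exact hx.2 (h hx'.2)
      · exact Set.disjoint_left.1 h hx'.1 hx.1
    have d₂ : Disjoint (Cᶜ ×ˢ C) (B ×ˢ B) := by
      refine Set.disjoint_left.2 fun x hx hx' => ?_
      rcases hsep with h | h
      · exact hx.1 (h hx'.1)
      · exact Set.disjoint_left.1 h hx'.2 hx.2
    rw [Measure.add_apply, Measure.add_apply, hρ _ d₁, hρ _ d₂, zero_add, zero_add]
    exact g₃ C (Finset.mem_erase.2 ⟨hCB, hC⟩)

end Laminar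

section Coupling

variable {X : Type*} [MeasurableSpace X] {μ ν : Measure X} {π : Measure (X × X)}

lemma IsCoupling.measureReal_left_eq (h : IsCoupling π μ ν) {B : Set X} (hB : MeasurableSet B) :
    μ.real B = π.real (B ×ˢ B) + π.real (B ×ˢ Bᶜ) := by
  have := h.1
  rw [← h.2.1, map_measureReal_apply measurable_fst hB,
    ← measureReal_union (Set.disjoint_left.2 fun x hx hx' => hx'.2 hx.2) (hB.prod hB.compl),
    ← Set.prod_union, Set.union_compl_self, Set.prod_univ]

lemma IsCoupling.measureReal_right_eq (h : IsCoupling π μ ν) {B : Set X} (hB : MeasurableSet B) :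
    ν.real B = π.real (B ×ˢ B) + π.real (Bᶜ ×ˢ B) := by
  have := h.1
  rw [← h.2.2, map_measureReal_apply measurable_snd hB,
    ← measureReal_union (Set.disjoint_left.2 fun x hx hx' => hx'.1 hx.1) (hB.compl.prod hB),
    ← Set.union_prod, Set.union_compl_self, Set.univ_prod]

lemma IsCoupling.ofReal_abs_sub_le (h : IsCoupling π μ ν) {B : Set X} (hB : MeasurableSet B) :
    ENNReal.ofReal |μ.real B - ν.real B| ≤ π (B ×ˢ Bᶜ) + π (Bᶜ ×ˢ B) := by
  have := h.1
  rw [← ofReal_measureReal, ← ofReal_measureReal,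
    ← ENNReal.ofReal_add measureReal_nonneg measureReal_nonneg]
  refine ENNReal.ofReal_le_ofReal ?_
  rw [h.measureReal_left_eq hB, h.measureReal_right_eq hB, abs_le]
  constructor <;> linarith [measureReal_nonneg (μ := π) (s := B ×ˢ Bᶜ),
    measureReal_nonneg (μ := π) (s := Bᶜ ×ˢ B)]

lemma IsCoupling.ofReal_abs_sub_eq (h : IsCoupling π μ ν) {B : Set X} (hB : MeasurableSet B)
    (h0 : π (B ×ˢ Bᶜ) = 0 ∨ π (Bᶜ ×ˢ B) = 0) :
    ENNReal.ofReal |μ.real B - ν.real B| = π (B ×ˢ Bᶜ) + π (Bᶜ ×ˢ B) := by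
  have := h.1
  have h0' : π.real (B ×ˢ Bᶜ) = 0 ∨ π.real (Bᶜ ×ˢ B) = 0 := by
    simpa [measureReal_eq_zero_iff] using h0
  rw [← ofReal_measureReal, ← ofReal_measureReal,
    ← ENNReal.ofReal_add measureReal_nonneg measureReal_nonneg,
    h.measureReal_left_eq hB, h.measureReal_right_eq hB]
  rcases h0' with h0' | h0' <;> rw [h0'] <;> simp [abs_of_nonneg]

lemma IsCoupling.map_swap (h : IsCoupling π μ ν) : IsCoupling (π.map Prod.swap) ν μ := by
  have := h.1
  refine ⟨Measure.isProbabilityMeasure_map measurable_swap.aemeasurable, ?_, ?_⟩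
  · rw [Measure.map_map measurable_fst measurable_swap]
    exact h.2.2
  · rw [Measure.map_map measurable_snd measurable_swap]
    exact h.2.1

lemma isCoupling_prod (μ ν : Measure X) [IsProbabilityMeasure μ] [IsProbabilityMeasure ν] :
    IsCoupling (μ.prod ν) μ ν :=
  ⟨inferInstance, by simp, by simp⟩

end Coupling

section Transport

variable {X : Type*} [MetricSpace X] [CompactSpace X] [MeasurableSpace X] [BorelSpace X]
  {p : ℝ} {par : Set X → Set X}

omit [CompactSpace X] in
lemma measurableSet_ballsWithParent {B : Set X} (hB : B ∈ BallsWithParent X) : MeasurableSet B :=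
  hB.1.isClosed.measurableSet

lemma measurable_ofReal_dist_rpow (p : ℝ) :
    Measurable fun x : X × X => ENNReal.ofReal (dist x.1 x.2 ^ p) := by
  fun_prop

lemma lintegral_dist_rpow_map_swap (p : ℝ) (π : Measure (X × X)) :
    ∫⁻ x, ENNReal.ofReal (dist x.1 x.2 ^ p) ∂(π.map Prod.swap) =
      ∫⁻ x, ENNReal.ofReal (dist x.1 x.2 ^ p) ∂π := by
  rw [lintegral_map (measurable_ofReal_dist_rpow p) measurable_swap]
  simp [dist_comm]

omit [BorelSpace X] in
lemma lintegral_dist_rpow_ne_top (hp : 0 < p) (π : Measure (X × X)) [IsFiniteMeasure π] :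
    ∫⁻ x, ENNReal.ofReal (dist x.1 x.2 ^ p) ∂π ≠ ∞ := by
  have hle (x : X × X) : ENNReal.ofReal (dist x.1 x.2 ^ p) ≤
      ENNReal.ofReal (Metric.diam (Set.univ : Set X) ^ p) :=
    ENNReal.ofReal_le_ofReal (Real.rpow_le_rpow dist_nonneg (Metric.dist_le_diam_of_mem
      Metric.isBounded_of_compactSpace (Set.mem_univ _) (Set.mem_univ _)) hp.le)
  refine ne_top_of_le_ne_top ?_ (lintegral_mono hle)
  rw [lintegral_const]
  exact ENNReal.mul_ne_top ENNReal.ofReal_ne_top (measure_ne_top _ _)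

variable [IsUltrametricDist X]

lemma lintegral_tsum_indicator_prod_compl (π : Measure (X × X)) (w : Set X → ℝ≥0∞) :
    ∫⁻ x, ∑' B : BallsWithParent X, ((B : Set X) ×ˢ (B : Set X)ᶜ).indicator (fun _ => w B) x ∂π =
      ∑' B : BallsWithParent X, w B * π ((B : Set X) ×ˢ (B : Set X)ᶜ) := by
  have : Countable (BallsWithParent X) := countable_ballsWithParent.to_subtype
  have hm (B : BallsWithParent X) : MeasurableSet ((B : Set X) ×ˢ (B : Set X)ᶜ) :=
    (measurableSet_ballsWithParent B.2).prod (measurableSet_ballsWithParent B.2).compl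
  rw [lintegral_tsum fun B => (measurable_const.indicator (hm B)).aemeasurable]
  exact tsum_congr fun B => lintegral_indicator_const (hm B) _

lemma lintegral_dist_rpow_eq_tsum (hp : 0 < p)
    (hpar : ∀ B ∈ BallsWithParent X, IsLeast {C | IsCBall C ∧ B ⊂ C} (par B))
    (π : Measure (X × X)) :
    ∫⁻ x, ENNReal.ofReal (dist x.1 x.2 ^ p) ∂π = ∑' B : BallsWithParent X,
      ENNReal.ofReal (Metric.diam (par B) ^ p - Metric.diam (B : Set X) ^ p) *
        π ((B : Set X) ×ˢ (B : Set X)ᶜ) := by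
  rw [← lintegral_tsum_indicator_prod_compl π fun B =>
    ENNReal.ofReal (Metric.diam (par B) ^ p - Metric.diam B ^ p)]
  refine lintegral_congr fun x => ?_
  rw [← tsum_diam_rpow_sub_separating hp hpar]
  refine tsum_congr fun B => ?_
  by_cases h : x.1 ∈ (B : Set X) ∧ x.2 ∉ (B : Set X) <;> simp [Set.indicator, h]

/-- The balls whose parent has diameter at most `ε` contribute at most `ε ^ p` to the cost. -/
lemma lintegral_dist_rpow_le_tsum_add (hp : 0 < p)
    (hpar : ∀ B ∈ BallsWithParent X, IsLeast {C | IsCBall C ∧ B ⊂ C} (par B))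
    (π : Measure (X × X)) [IsProbabilityMeasure π] (ε : ℝ) :
    ∫⁻ x, ENNReal.ofReal (dist x.1 x.2 ^ p) ∂π ≤ (∑' B : BallsWithParent X,
      {B : Set X | ε < Metric.diam (par B)}.indicator (fun B =>
        ENNReal.ofReal (Metric.diam (par B) ^ p - Metric.diam B ^ p)) (B : Set X) *
        π ((B : Set X) ×ˢ (B : Set X)ᶜ)) + ENNReal.ofReal (ε ^ p) := by
  rw [← lintegral_tsum_indicator_prod_compl π
    ({B : Set X | ε < Metric.diam (par B)}.indicator fun B =>
      ENNReal.ofReal (Metric.diam (par B) ^ p - Metric.diam B ^ p))]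
  have hconst : ENNReal.ofReal (ε ^ p) = ∫⁻ _, ENNReal.ofReal (ε ^ p) ∂π := by simp
  rw [hconst, ← lintegral_add_right _ measurable_const]
  refine lintegral_mono fun x => ?_
  rw [← tsum_diam_rpow_sub_separating hp hpar]
  refine le_trans ?_ (add_le_add_right (tsum_diam_rpow_sub_small_le hp hpar x.1 ε) _)
  rw [← ENNReal.tsum_add]
  refine ENNReal.tsum_le_tsum fun B => ?_
  by_cases h₁ : x.1 ∈ (B : Set X) <;> by_cases h₂ : x.2 ∈ (B : Set X) <;>
    by_cases h₃ : ε < Metric.diam (par B) <;> simp [Set.indicator, h₁, h₂, h₃, not_lt.1]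

lemma IsCoupling.tsum_le_two_mul_lintegral {μ ν : Measure X} {π : Measure (X × X)}
    (h : IsCoupling π μ ν) (hp : 0 < p)
    (hpar : ∀ B ∈ BallsWithParent X, IsLeast {C | IsCBall C ∧ B ⊂ C} (par B)) :
    ∑' B : BallsWithParent X,
        ENNReal.ofReal (Metric.diam (par B) ^ p - Metric.diam (B : Set X) ^ p) *
          ENNReal.ofReal |μ.real (B : Set X) - ν.real (B : Set X)| ≤
      2 * ∫⁻ x, ENNReal.ofReal (dist x.1 x.2 ^ p) ∂π := by
  rw [two_mul]
  nth_rw 2 [← lintegral_dist_rpow_map_swap]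
  rw [lintegral_dist_rpow_eq_tsum hp hpar, lintegral_dist_rpow_eq_tsum hp hpar, ← ENNReal.tsum_add]
  refine ENNReal.tsum_le_tsum fun B => ?_
  have hB := measurableSet_ballsWithParent B.2
  rw [Measure.map_apply measurable_swap (hB.prod hB.compl), Set.preimage_swap_prod, ← mul_add]
  exact mul_le_mul_right (h.ofReal_abs_sub_le hB) _

lemma exists_isCoupling_two_mul_lintegral_le (μ ν : Measure X) [IsProbabilityMeasure μ]
    [IsProbabilityMeasure ν] (hp : 0 < p)
    (hpar : ∀ B ∈ BallsWithParent X, IsLeast {C | IsCBall C ∧ B ⊂ C} (par B))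
    {ε : ℝ} (hε : 0 < ε) :
    ∃ π, IsCoupling π μ ν ∧ 2 * ∫⁻ x, ENNReal.ofReal (dist x.1 x.2 ^ p) ∂π ≤
      (∑' B : BallsWithParent X,
        ENNReal.ofReal (Metric.diam (par B) ^ p - Metric.diam (B : Set X) ^ p) *
          ENNReal.ofReal |μ.real (B : Set X) - ν.real (B : Set X)|) +
        2 * ENNReal.ofReal (ε ^ p) := by
  have hfin := finite_ballsWithParent_lt_diam (X := X) hε
  obtain ⟨π, h₁, h₂, h₃⟩ := exists_laminar_measure_prod hfin.toFinset
    (fun B hB => (hfin.mem_toFinset.1 hB).1.isClosed.measurableSet)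
    (fun B hB C hC => by
      obtain ⟨x, r, -, rfl⟩ := (hfin.mem_toFinset.1 hB).1
      obtain ⟨y, s, -, rfl⟩ := (hfin.mem_toFinset.1 hC).1
      exact IsUltrametricDist.closedBall_subset_trichotomy x y r s) μ ν (by simp)
  have hπ : IsCoupling π μ ν := by
    refine ⟨⟨?_⟩, h₁, h₂⟩
    rw [← Set.preimage_univ (f := Prod.fst), ← Measure.map_apply measurable_fst MeasurableSet.univ,
      h₁, measure_univ]
  have := hπ.1
  have := hπ.map_swap.1
  refine ⟨π, hπ, ?_⟩
  rw [two_mul]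
  nth_rw 2 [← lintegral_dist_rpow_map_swap]
  refine (add_le_add (lintegral_dist_rpow_le_tsum_add hp hpar π ε)
    (lintegral_dist_rpow_le_tsum_add hp hpar (π.map Prod.swap) ε)).trans ?_
  rw [add_add_add_comm, ← ENNReal.tsum_add, ← two_mul]
  refine add_le_add_left (ENNReal.tsum_le_tsum fun B => ?_) _
  have hB := measurableSet_ballsWithParent B.2
  rw [Measure.map_apply measurable_swap (hB.prod hB.compl), Set.preimage_swap_prod, ← mul_add]
  by_cases hε' : ε < Metric.diam (par B)
  · rw [hπ.ofReal_abs_sub_eq hB (h₃ B (hfin.mem_toFinset.2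
      ⟨B.2.1, par B, hpar B B.2, hε'⟩))]
    exact mul_le_mul_left (Set.indicator_le_self _ _ _) _
  · simp [Set.indicator, hε']

end Transport

/-- Lemma 3.1: in a compact ultrametric space, `W_p(μ,ν)^p` is a weighted `ℓ¹` distance
between the functions `B ↦ μ(B)` on the countable family of balls admitting a parent. -/
theorem wasserstein_pow_eq_sum_over_balls
    {X : Type*} [MetricSpace X] [CompactSpace X] [MeasurableSpace X] [BorelSpace X]
    (hX : ∀ x y z : X, dist x z ≤ max (dist x y) (dist y z))
    (p : ℝ) (hp : 1 ≤ p) :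
    (BallsWithParent X).Countable ∧
    ∀ par : Set X → Set X,
      (∀ B ∈ BallsWithParent X, IsLeast {C | IsCBall C ∧ B ⊂ C} (par B)) →
      ∀ μ ν : ProbabilityMeasure X,
        Summable (fun B : BallsWithParent X =>
          (Metric.diam (par B) ^ p - Metric.diam (B : Set X) ^ p) *
            |((μ (B : Set X) : ℝ)) - ((ν (B : Set X) : ℝ))|) ∧
        Wp p (μ : Measure X) (ν : Measure X) ^ p =
          (1 / 2) * ∑' B : BallsWithParent X,
            (Metric.diam (par B) ^ p - Metric.diam (B : Set X) ^ p) *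
              |((μ (B : Set X) : ℝ)) - ((ν (B : Set X) : ℝ))| := by
  have : IsUltrametricDist X := ⟨hX⟩
  refine ⟨countable_ballsWithParent, fun par hpar μ ν => ?_⟩
  have hp0 : 0 < p := by linarith
  set w : BallsWithParent X → ℝ := fun B => Metric.diam (par B) ^ p - Metric.diam (B : Set X) ^ p
  set f : BallsWithParent X → ℝ := fun B =>
    w B * |(μ : Measure X).real (B : Set X) - (ν : Measure X).real (B : Set X)|
  change Summable f ∧ _ = 1 / 2 * ∑' B, f B
  have hw (B : BallsWithParent X) : 0 ≤ w B := by
    refine sub_nonneg.2 (Real.rpow_le_rpow Metric.diam_nonneg ?_ hp0.le)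
    exact Metric.diam_mono (hpar B B.2).1.2.1 Metric.isBounded_of_compactSpace
  have hf (B : BallsWithParent X) : 0 ≤ f B := mul_nonneg (hw B) (abs_nonneg _)
  have hterm : (∑' B : BallsWithParent X,
      ENNReal.ofReal (Metric.diam (par B) ^ p - Metric.diam (B : Set X) ^ p) *
        ENNReal.ofReal |(μ : Measure X).real (B : Set X) - (ν : Measure X).real (B : Set X)|) =
      ∑' B, ENNReal.ofReal (f B) :=
    tsum_congr fun B => (ENNReal.ofReal_mul (hw B)).symm
  have hle (π) (hπ : IsCoupling π (μ : Measure X) (ν : Measure X)) :=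
    hterm ▸ hπ.tsum_le_two_mul_lintegral hp0 hpar
  have hprod := isCoupling_prod (μ : Measure X) (ν : Measure X)
  have hsum : Summable f := by
    have hne : ∑' B, ENNReal.ofReal (f B) ≠ ∞ :=
      ne_top_of_le_ne_top (ENNReal.mul_ne_top ENNReal.ofNat_ne_top
        (lintegral_dist_rpow_ne_top hp0 _)) (hle _ hprod)
    simpa [ENNReal.toReal_ofReal (hf _)] using ENNReal.summable_toReal hne
  refine ⟨hsum, ?_⟩
  rw [← ENNReal.ofReal_tsum_of_nonneg hf hsum] at hterm hle
  have hint (π : Measure (X × X)) (hπ : IsProbabilityMeasure π) :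
      ENNReal.ofReal (∫ x, dist x.1 x.2 ^ p ∂π) =
        ∫⁻ x, ENNReal.ofReal (dist x.1 x.2 ^ p) ∂π := by
    rw [integral_eq_lintegral_of_nonneg_ae (Filter.Eventually.of_forall fun x => by positivity)
      (by fun_prop (disch := exact hp0.le)), ENNReal.ofReal_toReal (lintegral_dist_rpow_ne_top hp0 π)]
  have hint0 (π : Measure (X × X)) : 0 ≤ ∫ x, dist x.1 x.2 ^ p ∂π :=
    integral_nonneg fun x => by positivity
  have hbound : ∀ c ∈ {c : ℝ | ∃ π : Measure (X × X), IsCoupling π (μ : Measure X) (ν : Measure X) ∧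
      c = ∫ ab, dist ab.1 ab.2 ^ p ∂π}, 1 / 2 * ∑' B, f B ≤ c := by
    rintro c ⟨π, hπ, rfl⟩
    have := hle π hπ
    rw [← hint π hπ.1, ← ENNReal.ofReal_ofNat, ← ENNReal.ofReal_mul zero_le_two,
      ENNReal.ofReal_le_ofReal_iff (mul_nonneg zero_le_two (hint0 π))] at this
    linarith
  have htot : 0 ≤ ∑' B, f B := tsum_nonneg hf
  have hinf : sInf {c : ℝ | ∃ π : Measure (X × X), IsCoupling π (μ : Measure X) (ν : Measure X) ∧
      c = ∫ ab, dist ab.1 ab.2 ^ p ∂π} = 1 / 2 * ∑' B, f B := by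
    refine le_antisymm (le_of_forall_pos_le_add fun δ hδ => ?_)
      (le_csInf ⟨_, _, hprod, rfl⟩ hbound)
    obtain ⟨π, hπ, hπle⟩ := exists_isCoupling_two_mul_lintegral_le (μ : Measure X) (ν : Measure X)
      hp0 hpar (ε := δ ^ p⁻¹) (by positivity)
    refine (csInf_le ⟨_, hbound⟩ ⟨π, hπ, rfl⟩).trans ?_
    rw [hterm, ← hint π hπ.1, Real.rpow_inv_rpow hδ.le hp0.ne', ← ENNReal.ofReal_ofNat,
      ← ENNReal.ofReal_mul zero_le_two, ← ENNReal.ofReal_mul zero_le_two,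
      ← ENNReal.ofReal_add htot (by positivity),
      ENNReal.ofReal_le_ofReal_iff (by positivity)] at hπle
    linarith
  rw [Wp, hinf, one_div p, Real.rpow_inv_rpow (by positivity) hp0.ne']
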